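/- Suppose Δ > 0 and X = (Uᵀ Jᵀ)ᵀ ∈ R. Then ‖Σ_r − XXᵀ‖_F ≤ r·σ₁(Λ_r − UUᵀ) + 2·r·√(2·λ₁*)·σ₁(J). Moreover, in the exact rank-r case where λ_{r+1}* = ⋯ = λ_d* = 0, for any gradient descent iterate X_t with η·σ₁(X_t)² ≤ 1 one has σ₁(J_{t+1}) ≤ (1 − η·σ_r(X_t)²)·σ₁(J_t). -/

import Mathlib

open Matrix

/-- The largest singular value of a real matrix. -/
noncomputable def sigmaMax {m n : ℕ} (M : Matrix (Fin m) (Fin n) ℝ) : ℝ :=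
  sSup {c : ℝ | ∃ v : EuclideanSpace ℝ (Fin n), ‖v‖ = 1 ∧
    c = ‖(EuclideanSpace.equiv (Fin m) ℝ).symm (M.mulVec ((EuclideanSpace.equiv (Fin n) ℝ) v))‖}

/-- The smallest singular value (the `n`-th largest, for a matrix with `n` columns). -/
noncomputable def sigmaMin {m n : ℕ} (M : Matrix (Fin m) (Fin n) ℝ) : ℝ :=
  sInf {c : ℝ | ∃ v : EuclideanSpace ℝ (Fin n), ‖v‖ = 1 ∧
    c = ‖(EuclideanSpace.equiv (Fin m) ℝ).symm (M.mulVec ((EuclideanSpace.equiv (Fin n) ℝ) v))‖}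

/-- Frobenius norm of a real matrix. -/
noncomputable def frobNorm {m n : ℕ} (M : Matrix (Fin m) (Fin n) ℝ) : ℝ :=
  Real.sqrt (∑ i, ∑ j, (M i j) ^ 2)

/-- Gradient descent iterates `X_{t+1} = X_t + η (Σ - X_t X_tᵀ) X_t`. -/
noncomputable def gdIter {d r : ℕ} (S : Matrix (Fin d) (Fin d) ℝ) (η : ℝ)
    (X0 : Matrix (Fin d) (Fin r) ℝ) : ℕ → Matrix (Fin d) (Fin r) ℝ
  | 0 => X0
  | t + 1 => gdIter S η X0 t +
      η • ((S - gdIter S η X0 t * (gdIter S η X0 t)ᵀ) * gdIter S η X0 t)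

/-- The top `r × r` block `U` (first `r` rows) of `X ∈ ℝ^{d×r}`. -/
def topBlock {d r : ℕ} (h : r ≤ d) (X : Matrix (Fin d) (Fin r) ℝ) :
    Matrix (Fin r) (Fin r) ℝ :=
  fun i j => X (Fin.castLE h i) j

/-- The bottom `(d-r) × r` block `J` (last `d-r` rows) of `X ∈ ℝ^{d×r}`. -/
def botBlock {d r : ℕ} (X : Matrix (Fin d) (Fin r) ℝ) :
    Matrix (Fin (d - r)) (Fin r) ℝ :=
  fun i j => X ⟨r + (i : ℕ), by have := i.isLt; omega⟩ j

/-- The region `R = {X : σ₁(X)² ≤ 2λ₁*, σ₁(J)² ≤ λ_r* − Δ/2, σ_r(U)² ≥ Δ/4}`. -/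
def inR {d r : ℕ} (h : r ≤ d) (lam1 lamr Δ : ℝ) (X : Matrix (Fin d) (Fin r) ℝ) : Prop :=
  sigmaMax X ^ 2 ≤ 2 * lam1 ∧ sigmaMax (botBlock X) ^ 2 ≤ lamr - Δ / 2 ∧
    Δ / 4 ≤ sigmaMin (topBlock h X) ^ 2

/-- The region `R₂ = {X : σ₁(X)² ≤ 2λ₁*, σ₁(J)² ≤ λ_r* − Δ/2}`. -/
def inR2 {d r : ℕ} (lam1 lamr Δ : ℝ) (X : Matrix (Fin d) (Fin r) ℝ) : Prop :=
  sigmaMax X ^ 2 ≤ 2 * lam1 ∧ sigmaMax (botBlock X) ^ 2 ≤ lamr - Δ / 2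


theorem norm_equiv_symm_sq {m : ℕ} (w : Fin m → ℝ) :
    ‖(EuclideanSpace.equiv (Fin m) ℝ).symm w‖ ^ 2 = w ⬝ᵥ w := by
  rw [EuclideanSpace.real_norm_sq_eq]
  simp [dotProduct, sq]

theorem sigmaMax_nonneg {m n : ℕ} (M : Matrix (Fin m) (Fin n) ℝ) : 0 ≤ sigmaMax M := by
  apply Real.sSup_nonneg
  rintro c ⟨v, -, rfl⟩
  exact norm_nonneg _

theorem sigmaMin_nonneg {m n : ℕ} (M : Matrix (Fin m) (Fin n) ℝ) : 0 ≤ sigmaMin M := by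
  apply Real.sInf_nonneg
  rintro c ⟨v, -, rfl⟩
  exact norm_nonneg _

theorem norm_mulVec_le_sigmaMax {m n : ℕ} (M : Matrix (Fin m) (Fin n) ℝ)
    {v : EuclideanSpace ℝ (Fin n)} (hv : ‖v‖ = 1) :
    ‖(EuclideanSpace.equiv (Fin m) ℝ).symm (M *ᵥ EuclideanSpace.equiv (Fin n) ℝ v)‖ ≤
      sigmaMax M := by
  refine le_csSup ⟨‖LinearMap.toContinuousLinearMap (Matrix.toEuclideanLin M)‖, ?_⟩ ⟨v, hv, rfl⟩
  rintro c ⟨w, hw, rfl⟩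
  have h := (LinearMap.toContinuousLinearMap (Matrix.toEuclideanLin M)).le_opNorm w
  rw [hw, mul_one] at h
  exact h

theorem sigmaMin_le_norm_mulVec {m n : ℕ} (M : Matrix (Fin m) (Fin n) ℝ)
    {v : EuclideanSpace ℝ (Fin n)} (hv : ‖v‖ = 1) :
    sigmaMin M ≤
      ‖(EuclideanSpace.equiv (Fin m) ℝ).symm (M *ᵥ EuclideanSpace.equiv (Fin n) ℝ v)‖ := by
  refine csInf_le ⟨0, ?_⟩ ⟨v, hv, rfl⟩
  rintro c ⟨w, -, rfl⟩
  exact norm_nonneg _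

theorem exists_eq_smul_unit {n : ℕ} {v : Fin n → ℝ} (hv : v ≠ 0) :
    ∃ (a : ℝ) (u : EuclideanSpace ℝ (Fin n)), ‖u‖ = 1 ∧
      v = a • EuclideanSpace.equiv (Fin n) ℝ u ∧ v ⬝ᵥ v = a ^ 2 := by
  set x := (EuclideanSpace.equiv (Fin n) ℝ).symm v with hx
  have hx0 : x ≠ 0 := by simpa [hx] using hv
  refine ⟨‖x‖, ‖x‖⁻¹ • x, norm_smul_inv_norm hx0, ?_, ?_⟩
  · rw [map_smul, smul_smul, mul_inv_cancel₀ (norm_ne_zero_iff.mpr hx0), one_smul, hx,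
      ContinuousLinearEquiv.apply_symm_apply]
  · rw [hx, norm_equiv_symm_sq]

theorem dotProduct_mulVec_self_le {m n : ℕ} (M : Matrix (Fin m) (Fin n) ℝ) (v : Fin n → ℝ) :
    (M *ᵥ v) ⬝ᵥ (M *ᵥ v) ≤ sigmaMax M ^ 2 * (v ⬝ᵥ v) := by
  by_cases hv : v = 0
  · simp [hv]
  obtain ⟨a, u, hu, hau, hsq⟩ := exists_eq_smul_unit hv
  have h := pow_le_pow_left₀ (norm_nonneg _) (norm_mulVec_le_sigmaMax M hu) 2
  rw [norm_equiv_symm_sq] at h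
  rw [hsq, hau, mulVec_smul, smul_dotProduct, dotProduct_smul, smul_eq_mul, smul_eq_mul]
  nlinarith [mul_le_mul_of_nonneg_left h (sq_nonneg a)]

theorem le_dotProduct_mulVec_self {m n : ℕ} (M : Matrix (Fin m) (Fin n) ℝ) (v : Fin n → ℝ) :
    sigmaMin M ^ 2 * (v ⬝ᵥ v) ≤ (M *ᵥ v) ⬝ᵥ (M *ᵥ v) := by
  by_cases hv : v = 0
  · simp [hv]
  obtain ⟨a, u, hu, hau, hsq⟩ := exists_eq_smul_unit hv
  have h := pow_le_pow_left₀ (sigmaMin_nonneg M) (sigmaMin_le_norm_mulVec M hu) 2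
  rw [norm_equiv_symm_sq] at h
  rw [hsq, hau, mulVec_smul, smul_dotProduct, dotProduct_smul, smul_eq_mul, smul_eq_mul]
  nlinarith [mul_le_mul_of_nonneg_left h (sq_nonneg a)]

theorem sigmaMax_le {m n : ℕ} {M : Matrix (Fin m) (Fin n) ℝ} {c : ℝ} (hc : 0 ≤ c)
    (h : ∀ v, (M *ᵥ v) ⬝ᵥ (M *ᵥ v) ≤ c ^ 2 * (v ⬝ᵥ v)) : sigmaMax M ≤ c := by
  apply Real.sSup_le _ hc
  rintro _ ⟨v, hv, rfl⟩
  apply le_of_sq_le_sq _ hc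
  have hvv := norm_equiv_symm_sq (EuclideanSpace.equiv (Fin n) ℝ v)
  rw [ContinuousLinearEquiv.symm_apply_apply, hv] at hvv
  rw [norm_equiv_symm_sq]
  simpa [← hvv] using h (EuclideanSpace.equiv (Fin n) ℝ v)

theorem sum_sq_le_sigmaMax {m n : ℕ} (M : Matrix (Fin m) (Fin n) ℝ) :
    ∑ i, ∑ j, M i j ^ 2 ≤ n * sigmaMax M ^ 2 := by
  rw [Finset.sum_comm]
  have h : ∀ j ∈ Finset.univ, ∑ i, M i j ^ 2 ≤ sigmaMax M ^ 2 := fun j _ => by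
    simpa [dotProduct, sq, Pi.single_apply] using dotProduct_mulVec_self_le M (Pi.single j 1)
  simpa using Finset.sum_le_sum h

theorem sum_sq_mul_transpose_le {m n k : ℕ} (A : Matrix (Fin m) (Fin n) ℝ)
    (B : Matrix (Fin k) (Fin n) ℝ) :
    ∑ i, ∑ j, (A * Bᵀ) i j ^ 2 ≤ sigmaMax A ^ 2 * (n * sigmaMax B ^ 2) := by
  calc ∑ i, ∑ j, (A * Bᵀ) i j ^ 2 = ∑ j, (A *ᵥ B j) ⬝ᵥ (A *ᵥ B j) := by
        rw [Finset.sum_comm]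
        simp [dotProduct, mulVec, mul_apply, sq]
    _ ≤ ∑ j, sigmaMax A ^ 2 * (B j ⬝ᵥ B j) :=
        Finset.sum_le_sum fun j _ => dotProduct_mulVec_self_le A (B j)
    _ = sigmaMax A ^ 2 * ∑ i, ∑ j, B i j ^ 2 := by
        rw [Finset.mul_sum]
        simp [dotProduct, sq]
    _ ≤ _ := mul_le_mul_of_nonneg_left (sum_sq_le_sigmaMax B) (sq_nonneg _)

theorem sum_univ_eq_top_add_bot {d r : ℕ} (h : r ≤ d) (f : Fin d → ℝ) :
    ∑ i, f i = ∑ i : Fin r, f (Fin.castLE h i) +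
      ∑ i : Fin (d - r), f ⟨r + (i : ℕ), by have := i.isLt; omega⟩ := by
  have e : r + (d - r) = d := by omega
  rw [← (finCongr e).sum_comp, Fin.sum_univ_add]
  rfl

theorem frobNorm_sub_mul_transpose_le {d r : ℕ} (h : r ≤ d) (lam : Fin d → ℝ)
    (X : Matrix (Fin d) (Fin r) ℝ) {L : ℝ} (hL : 0 ≤ L) (hX : sigmaMax X ^ 2 ≤ L) :
    frobNorm (diagonal (fun i : Fin d => if (i : ℕ) < r then lam i else 0) - X * Xᵀ) ≤
      r * sigmaMax (diagonal (fun i : Fin r => lam (Fin.castLE h i)) -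
          topBlock h X * (topBlock h X)ᵀ) +
        2 * r * Real.sqrt L * sigmaMax (botBlock X) := by
  set D := diagonal (fun i : Fin r => lam (Fin.castLE h i)) -
    topBlock h X * (topBlock h X)ᵀ with hD
  set J := botBlock X with hJ
  have ha := sigmaMax_nonneg D
  have hb := sigmaMax_nonneg J
  have hs := Real.sqrt_nonneg L
  have hs2 := Real.sq_sqrt hL
  have hDs := sum_sq_le_sigmaMax D
  have hXJ := sum_sq_mul_transpose_le X J
  have hsplit := sum_univ_eq_top_add_bot h (fun i => ∑ j, (X * Jᵀ) i j ^ 2)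
  have hXJ' : ∑ i, ∑ j, (X * Jᵀ) i j ^ 2 ≤ r * (Real.sqrt L * sigmaMax J) ^ 2 := by
    refine hXJ.trans ?_
    rw [mul_pow, hs2]
    nlinarith [mul_le_mul_of_nonneg_right hX
      (by positivity : (0 : ℝ) ≤ r * sigmaMax J ^ 2)]
  have hbot : 0 ≤ ∑ i : Fin (d - r), ∑ j,
      (X * Jᵀ) ⟨r + (i : ℕ), by have := i.isLt; omega⟩ j ^ 2 := by positivity
  have htotal : ∑ i, ∑ j, (diagonal (fun i : Fin d => if (i : ℕ) < r then lam i else 0) -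
      X * Xᵀ) i j ^ 2 = ∑ i, ∑ j, D i j ^ 2 +
        ∑ i : Fin r, ∑ j, (X * Jᵀ) (Fin.castLE h i) j ^ 2 + ∑ i, ∑ j, (X * Jᵀ) i j ^ 2 := by
    have hcol : ∀ (i : Fin d) (j : Fin (d - r)),
        (diagonal (fun i : Fin d => if (i : ℕ) < r then lam i else 0) - X * Xᵀ) i
          ⟨r + (j : ℕ), by have := j.isLt; omega⟩ ^ 2 = (X * Jᵀ) i j ^ 2 := by
      intro i j
      have h0 : diagonal (fun i : Fin d => if (i : ℕ) < r then lam i else 0) i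
          ⟨r + (j : ℕ), by have := j.isLt; omega⟩ = 0 := by
        rw [diagonal_apply]
        split_ifs with h1 h2
        · subst h1
          simp at h2
        · rfl
        · rfl
      rw [Matrix.sub_apply, h0, zero_sub, neg_sq]
      rfl
    have hrow : ∀ (i : Fin (d - r)) (j : Fin r),
        (diagonal (fun i : Fin d => if (i : ℕ) < r then lam i else 0) - X * Xᵀ)
          ⟨r + (i : ℕ), by have := i.isLt; omega⟩ (Fin.castLE h j) ^ 2 =
        (X * Jᵀ) (Fin.castLE h j) i ^ 2 := by
      intro i j
      have hsymm : (diagonal (fun i : Fin d => if (i : ℕ) < r then lam i else 0) - X * Xᵀ)ᵀ =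
          diagonal (fun i : Fin d => if (i : ℕ) < r then lam i else 0) - X * Xᵀ := by simp
      rw [← hcol, ← hsymm, transpose_apply, hsymm]
    have htop : ∀ i j : Fin r,
        (diagonal (fun i : Fin d => if (i : ℕ) < r then lam i else 0) - X * Xᵀ)
          (Fin.castLE h i) (Fin.castLE h j) ^ 2 = D i j ^ 2 := by
      intro i j
      simp [hD, diagonal_apply, mul_apply, topBlock]
    simp_rw [fun i : Fin d => sum_univ_eq_top_add_bot h (fun j =>
      (diagonal (fun i : Fin d => if (i : ℕ) < r then lam i else 0) - X * Xᵀ) i j ^ 2), hcol,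
      Finset.sum_add_distrib]
    rw [sum_univ_eq_top_add_bot h]
    simp_rw [htop, hrow]
    rw [Finset.sum_comm (f := fun (i : Fin (d - r)) (j : Fin r) =>
      (X * Jᵀ) (Fin.castLE h j) i ^ 2)]
  have hr2 : (r : ℝ) ≤ (r : ℝ) ^ 2 := by
    exact_mod_cast Nat.le_self_pow two_ne_zero r
  have hc : 0 ≤ Real.sqrt L * sigmaMax J := mul_nonneg hs hb
  have hr0 : (0 : ℝ) ≤ r := Nat.cast_nonneg r
  apply Real.sqrt_le_iff.mpr
  refine ⟨by positivity, ?_⟩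
  rw [htotal]
  have h1 := mul_le_mul_of_nonneg_right hr2 (sq_nonneg (sigmaMax D))
  have h2 := mul_le_mul_of_nonneg_right hr2 (sq_nonneg (Real.sqrt L * sigmaMax J))
  have h3 : 0 ≤ (r * sigmaMax D) * (r * (Real.sqrt L * sigmaMax J)) := by positivity
  have h4 : 0 ≤ (r : ℝ) ^ 2 * (Real.sqrt L * sigmaMax J) ^ 2 := by positivity
  nlinarith

/-- A symmetric matrix whose quadratic form lies between `0` and `c` is `c`-Lipschitz. -/
theorem dotProduct_mulVec_self_le_of_quadForm_le {n : ℕ} {B : Matrix (Fin n) (Fin n) ℝ}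
    (hB : Bᵀ = B) {c : ℝ} (hc : 0 ≤ c) (h0 : ∀ v, 0 ≤ v ⬝ᵥ (B *ᵥ v))
    (h1 : ∀ v, v ⬝ᵥ (B *ᵥ v) ≤ c * (v ⬝ᵥ v)) (v : Fin n → ℝ) :
    (B *ᵥ v) ⬝ᵥ (B *ᵥ v) ≤ c ^ 2 * (v ⬝ᵥ v) := by
  have hsymm : ∀ x y, x ⬝ᵥ (B *ᵥ y) = y ⬝ᵥ (B *ᵥ x) := fun x y => by
    rw [dotProduct_mulVec, ← mulVec_transpose, hB, dotProduct_comm]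
  set w := B *ᵥ v with hw
  -- polarization, applied to `c • v` and `w`
  have hplus := h1 (c • v + w)
  have hminus := h0 (c • v - w)
  simp only [mulVec_add, mulVec_sub, mulVec_smul, add_dotProduct, sub_dotProduct, dotProduct_add,
    dotProduct_sub, smul_dotProduct, dotProduct_smul, smul_eq_mul, hsymm v w, ← hw] at hplus hminus
  have hvw : v ⬝ᵥ w ≤ c * (v ⬝ᵥ v) := h1 v
  rw [dotProduct_comm w v] at hplus
  rcases hc.eq_or_lt with rfl | hc
  · have h := h1 (v + w)
    have hw0 := h0 w
    have hv0 : 0 ≤ v ⬝ᵥ w := h0 v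
    simp only [mulVec_add, add_dotProduct, dotProduct_add, hsymm v w, ← hw] at h
    linarith
  · have := mul_le_mul_of_nonneg_left hvw (sq_nonneg c)
    refine le_of_mul_le_mul_left ?_ hc
    nlinarith

theorem botBlock_gradient_step {d r : ℕ} {lam : Fin d → ℝ}
    (h0 : ∀ i : Fin d, r ≤ (i : ℕ) → lam i = 0) (η : ℝ) (X : Matrix (Fin d) (Fin r) ℝ) :
    botBlock (X + η • ((diagonal lam - X * Xᵀ) * X)) = botBlock X * (1 - η • (Xᵀ * X)) := by
  ext i j
  have e : ∀ M : Matrix (Fin r) (Fin r) ℝ, (botBlock X * M) i j =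
      (X * M) ⟨r + (i : ℕ), by have := i.isLt; omega⟩ j := fun M => rfl
  rw [e, Matrix.sub_mul, Matrix.mul_sub, Matrix.mul_smul, Matrix.mul_one, Matrix.mul_assoc]
  simp [botBlock, diagonal_mul, h0, sub_eq_add_neg]

theorem sigmaMax_botBlock_gradient_step_le {d r : ℕ} (hr : 0 < r) {lam : Fin d → ℝ}
    (h0 : ∀ i : Fin d, r ≤ (i : ℕ) → lam i = 0) {η : ℝ} (hη : 0 ≤ η)
    (X : Matrix (Fin d) (Fin r) ℝ) (hX : η * sigmaMax X ^ 2 ≤ 1) :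
    sigmaMax (botBlock (X + η • ((diagonal lam - X * Xᵀ) * X))) ≤
      (1 - η * sigmaMin X ^ 2) * sigmaMax (botBlock X) := by
  rw [botBlock_gradient_step h0]
  have hquad : ∀ v, v ⬝ᵥ ((1 - η • (Xᵀ * X)) *ᵥ v) =
      v ⬝ᵥ v - η * ((X *ᵥ v) ⬝ᵥ (X *ᵥ v)) := fun v => by
    rw [sub_mulVec, one_mulVec, smul_mulVec, ← mulVec_mulVec, dotProduct_sub, dotProduct_smul,
      dotProduct_mulVec, vecMul_transpose, smul_eq_mul]
  have hc : 0 ≤ 1 - η * sigmaMin X ^ 2 := by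
    have hle := (le_dotProduct_mulVec_self X (Pi.single ⟨0, hr⟩ 1)).trans
      (dotProduct_mulVec_self_le X (Pi.single ⟨0, hr⟩ 1))
    simp only [single_dotProduct, Pi.single_eq_same, mul_one] at hle
    linarith [mul_le_mul_of_nonneg_left hle hη]
  have hB := dotProduct_mulVec_self_le_of_quadForm_le (B := 1 - η • (Xᵀ * X)) (by simp) hc
    (fun v => by
      rw [hquad]
      have hvv : 0 ≤ v ⬝ᵥ v := by simpa using dotProduct_star_self_nonneg v
      nlinarith [mul_le_mul_of_nonneg_left (dotProduct_mulVec_self_le X v) hη,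
        mul_le_mul_of_nonneg_right hX hvv])
    (fun v => by
      rw [hquad]
      nlinarith [mul_le_mul_of_nonneg_left (le_dotProduct_mulVec_self X v) hη])
  refine sigmaMax_le (mul_nonneg hc (sigmaMax_nonneg _)) fun v => ?_
  rw [← mulVec_mulVec]
  refine (dotProduct_mulVec_self_le _ _).trans ?_
  rw [mul_pow, mul_comm (_ ^ 2) (sigmaMax _ ^ 2), mul_assoc]
  exact mul_le_mul_of_nonneg_left (hB v) (sq_nonneg _)

/-- Error decomposition over `R`, and linear decay of `σ₁(J_t)` in the exact rank-`r` case. -/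
theorem error_decomposition_and_exact_rank (d r : ℕ) (hr : 0 < r) (hrd : r < d)
    (lam : Fin d → ℝ)
    (hmono : ∀ i j : Fin d, i ≤ j → lam j ≤ lam i)
    (hnn : ∀ i, 0 ≤ lam i)
    (η : ℝ) (hη : 0 < η)
    (hΔ : 0 < lam ⟨r - 1, by omega⟩ - lam ⟨r, hrd⟩)
    (X : Matrix (Fin d) (Fin r) ℝ)
    (hX : inR hrd.le (lam ⟨0, by omega⟩) (lam ⟨r - 1, by omega⟩)
      (lam ⟨r - 1, by omega⟩ - lam ⟨r, hrd⟩) X) :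
    (frobNorm
        (Matrix.diagonal (fun i : Fin d => if (i : ℕ) < r then lam i else 0) - X * Xᵀ) ≤
      r * sigmaMax
          (Matrix.diagonal (fun i : Fin r => lam (Fin.castLE hrd.le i)) -
            topBlock hrd.le X * (topBlock hrd.le X)ᵀ) +
        2 * r * Real.sqrt (2 * lam ⟨0, by omega⟩) * sigmaMax (botBlock X)) ∧
    ((∀ i : Fin d, r ≤ (i : ℕ) → lam i = 0) →
      ∀ (X0 : Matrix (Fin d) (Fin r) ℝ) (t : ℕ),
        η * sigmaMax (gdIter (Matrix.diagonal lam) η X0 t) ^ 2 ≤ 1 →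
        sigmaMax (botBlock (gdIter (Matrix.diagonal lam) η X0 (t + 1))) ≤
          (1 - η * sigmaMin (gdIter (Matrix.diagonal lam) η X0 t) ^ 2) *
            sigmaMax (botBlock (gdIter (Matrix.diagonal lam) η X0 t))) := by
  exact ⟨frobNorm_sub_mul_transpose_le hrd.le lam X (mul_nonneg zero_le_two (hnn _)) hX.1,
    fun h0 X0 t ht => sigmaMax_botBlock_gradient_step_le hr h0 hη.le _ ht⟩
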